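/- arXiv:1910.06647 — 7 statements merged into one kernel-verified Lean document; each statement's English description precedes it below -/
import Mathlib

section
/- Let n ≥ 1 be an integer and let δ ≤ 0 be a real number. Then for every r > 0 one has (n−1)·cs_δ(r)·∫₀^r sn_δ(t)^{n−1} dt ≤ sn_δ(r)^n. (This is the left inequality of Lemma 2.5(i) of the paper.) -/
open Real intervalIntegral

/-- `sn_δ` from the paper. -/
noncomputable def snDelta (δ t : ℝ) : ℝ :=
  if 0 < δ then Real.sin (Real.sqrt δ * t) / Real.sqrt δ
  else if δ = 0 then t
  else Real.sinh (Real.sqrt (-δ) * t) / Real.sqrt (-δ)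

/-- `cs_δ`, the derivative of `sn_δ`. -/
noncomputable def csDelta (δ t : ℝ) : ℝ :=
  if 0 < δ then Real.cos (Real.sqrt δ * t)
  else if δ = 0 then 1
  else Real.cosh (Real.sqrt (-δ) * t)

theorem csDelta_pos {δ : ℝ} (hδ : δ ≤ 0) (t : ℝ) : 0 < csDelta δ t := by
  rw [csDelta, if_neg hδ.not_gt]
  split_ifs
  · exact one_pos
  · exact Real.cosh_pos _

theorem snDelta_zero_right (δ : ℝ) : snDelta δ 0 = 0 := by
  simp [snDelta]

theorem snDelta_nonneg {δ t : ℝ} (hδ : δ ≤ 0) (ht : 0 ≤ t) : 0 ≤ snDelta δ t := by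
  rw [snDelta, if_neg hδ.not_gt]
  split_ifs
  · exact ht
  · exact div_nonneg (Real.sinh_nonneg_iff.2 (by positivity)) (Real.sqrt_nonneg _)

theorem hasDerivAt_snDelta {δ : ℝ} (hδ : δ ≤ 0) (t : ℝ) :
    HasDerivAt (snDelta δ) (csDelta δ t) t := by
  rcases hδ.eq_or_lt with rfl | h
  · have hs : snDelta 0 = id := by funext x; simp [snDelta]
    have hc : csDelta 0 t = 1 := by simp [csDelta]
    rw [hs, hc]
    exact hasDerivAt_id t
  · have hs : snDelta δ = fun x => Real.sinh (√(-δ) * x) / √(-δ) := by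
      funext x; simp [snDelta, hδ.not_gt, h.ne]
    have hc : csDelta δ t = Real.cosh (√(-δ) * t) := by simp [csDelta, hδ.not_gt, h.ne]
    have hq : √(-δ) ≠ 0 := (Real.sqrt_pos.2 (neg_pos.2 h)).ne'
    rw [hs, hc]
    exact (((hasDerivAt_id' t).const_mul √(-δ)).sinh.div_const √(-δ)).congr_deriv
      (by field_simp)

theorem hasDerivAt_csDelta {δ : ℝ} (hδ : δ ≤ 0) (t : ℝ) :
    HasDerivAt (csDelta δ) (-δ * snDelta δ t) t := by
  rcases hδ.eq_or_lt with rfl | h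
  · have hc : csDelta 0 = fun _ => 1 := by funext x; simp [csDelta]
    rw [hc, neg_zero, zero_mul]
    exact hasDerivAt_const t 1
  · have hs : snDelta δ t = Real.sinh (√(-δ) * t) / √(-δ) := by
      simp [snDelta, hδ.not_gt, h.ne]
    have hc : csDelta δ = fun x => Real.cosh (√(-δ) * x) := by
      funext x; simp [csDelta, hδ.not_gt, h.ne]
    have hq : √(-δ) ≠ 0 := (Real.sqrt_pos.2 (neg_pos.2 h)).ne'
    have hqq : √(-δ) * √(-δ) = -δ := Real.mul_self_sqrt (neg_nonneg.2 hδ)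
    rw [hs, hc]
    refine ((hasDerivAt_id' t).const_mul √(-δ)).cosh.congr_deriv ?_
    field_simp
    linear_combination Real.sinh (√(-δ) * t) * hqq

theorem csDelta_sq_add {δ : ℝ} (hδ : δ ≤ 0) (t : ℝ) :
    csDelta δ t ^ 2 + δ * snDelta δ t ^ 2 = 1 := by
  rcases hδ.eq_or_lt with rfl | h
  · simp [csDelta]
  · simp only [snDelta, csDelta, hδ.not_gt, h.ne, if_false]
    rw [div_pow, Real.sq_sqrt (neg_nonneg.2 hδ), Real.cosh_sq]
    field_simp [h.ne]
    ring

theorem hasDerivAt_snDelta_pow_div_csDelta {δ : ℝ} (hδ : δ ≤ 0) (m : ℕ) (t : ℝ) :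
    HasDerivAt (fun x => snDelta δ x ^ (m + 1) / csDelta δ x)
      (snDelta δ t ^ m * (m + 1 / csDelta δ t ^ 2)) t := by
  have hc := (csDelta_pos hδ t).ne'
  refine (((hasDerivAt_snDelta hδ t).fun_pow (m + 1)).fun_div
    (hasDerivAt_csDelta hδ t) hc).congr_deriv ?_
  simp only [Nat.add_sub_cancel, Nat.cast_add, Nat.cast_one]
  field_simp
  linear_combination snDelta δ t ^ m * csDelta_sq_add hδ t

/-- Left inequality of Lemma 2.5(i):
for `n ≥ 1`, `δ ≤ 0` and `r > 0`,
`(n-1)·cs_δ(r)·∫₀^r sn_δ(t)^{n-1} dt ≤ sn_δ(r)^n`. -/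
theorem sn_rel_nonpos_left (n : ℕ) (hn : 1 ≤ n) (δ : ℝ) (hδ : δ ≤ 0)
    (r : ℝ) (hr : 0 < r) :
    ((n : ℝ) - 1) * csDelta δ r * (∫ t in (0:ℝ)..r, snDelta δ t ^ (n - 1)) ≤
      snDelta δ r ^ n := by
  obtain ⟨m, rfl⟩ := Nat.exists_eq_add_of_le' hn
  have hsn : Continuous (snDelta δ) :=
    continuous_iff_continuousAt.2 fun t => (hasDerivAt_snDelta hδ t).continuousAt
  have hcs : Continuous (csDelta δ) :=
    continuous_iff_continuousAt.2 fun t => (hasDerivAt_csDelta hδ t).continuousAt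
  have hcont : Continuous fun t => snDelta δ t ^ m * (m + 1 / csDelta δ t ^ 2) :=
    (hsn.pow m).mul (continuous_const.add (continuous_const.div (hcs.pow 2)
      fun t => pow_ne_zero 2 (csDelta_pos hδ t).ne'))
  have hint := integral_eq_sub_of_hasDerivAt
    (fun t _ => hasDerivAt_snDelta_pow_div_csDelta hδ m t) (hcont.intervalIntegrable 0 r)
  have hle : ∫ t in (0:ℝ)..r, (m : ℝ) * snDelta δ t ^ m ≤
      ∫ t in (0:ℝ)..r, snDelta δ t ^ m * (m + 1 / csDelta δ t ^ 2) := by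
    refine integral_mono_on hr.le ((continuous_const.mul (hsn.pow m)).intervalIntegrable 0 r)
      (hcont.intervalIntegrable 0 r) fun t ht => ?_
    rw [mul_comm]
    exact mul_le_mul_of_nonneg_left (le_add_of_nonneg_right (by positivity))
      (pow_nonneg (snDelta_nonneg hδ ht.1) m)
  rw [hint, snDelta_zero_right, zero_pow m.succ_ne_zero, zero_div, sub_zero,
    integral_const_mul, le_div_iff₀ (csDelta_pos hδ r)] at hle
  rw [Nat.add_sub_cancel, Nat.cast_add, Nat.cast_one, add_sub_cancel_right]
  linarith
end

section
/- Let n ≥ 1 be an integer and let δ > 0 be a real number. Then for every r with 0 < r < π/√δ one has n·cs_δ(r)·∫₀^r sn_δ(t)^{n−1} dt ≤ sn_δ(r)^n. (This is Lemma 2.5(ii) of the paper.) -/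
open Real intervalIntegral

theorem snDelta_of_pos {δ : ℝ} (hδ : 0 < δ) (t : ℝ) :
    snDelta δ t = Real.sin (Real.sqrt δ * t) / Real.sqrt δ :=
  if_pos hδ

theorem csDelta_of_pos {δ : ℝ} (hδ : 0 < δ) (t : ℝ) :
    csDelta δ t = Real.cos (Real.sqrt δ * t) :=
  if_pos hδ

theorem hasDerivAt_snDelta_of_pos {δ : ℝ} (hδ : 0 < δ) (t : ℝ) :
    HasDerivAt (snDelta δ) (csDelta δ t) t := by
  have hs : Real.sqrt δ ≠ 0 := (Real.sqrt_pos.2 hδ).ne'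
  rw [funext (snDelta_of_pos hδ), csDelta_of_pos hδ]
  simpa [hs] using ((hasDerivAt_id t).const_mul (Real.sqrt δ)).sin.div_const (Real.sqrt δ)

theorem continuous_snDelta_of_pos {δ : ℝ} (hδ : 0 < δ) : Continuous (snDelta δ) := by
  rw [funext (snDelta_of_pos hδ)]
  fun_prop

theorem continuous_csDelta_of_pos {δ : ℝ} (hδ : 0 < δ) : Continuous (csDelta δ) := by
  rw [funext (csDelta_of_pos hδ)]
  fun_prop

theorem snDelta_nonneg_of_pos {δ t : ℝ} (hδ : 0 < δ) (ht : 0 ≤ t)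
    (ht' : t ≤ Real.pi / Real.sqrt δ) : 0 ≤ snDelta δ t := by
  have hs : 0 < Real.sqrt δ := Real.sqrt_pos.2 hδ
  rw [snDelta_of_pos hδ]
  exact div_nonneg (Real.sin_nonneg_of_nonneg_of_le_pi (by positivity)
    (by rwa [le_div_iff₀' hs] at ht')) hs.le

theorem csDelta_le_csDelta_of_pos {δ t r : ℝ} (hδ : 0 < δ) (ht : 0 ≤ t) (htr : t ≤ r)
    (hr : r ≤ Real.pi / Real.sqrt δ) : csDelta δ r ≤ csDelta δ t := by
  have hs : 0 < Real.sqrt δ := Real.sqrt_pos.2 hδ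
  rw [csDelta_of_pos hδ, csDelta_of_pos hδ]
  exact Real.cos_le_cos_of_nonneg_of_le_pi (by positivity)
    (by rwa [le_div_iff₀' hs] at hr) (by gcongr)

/-- Lemma 2.5(ii): for `n ≥ 1`, `δ > 0` and `0 < r < π/√δ`,
`n·cs_δ(r)·∫₀^r sn_δ(t)^{n-1} dt ≤ sn_δ(r)^n`. -/
theorem sn_rel_pos (n : ℕ) (hn : 1 ≤ n) (δ : ℝ) (hδ : 0 < δ)
    (r : ℝ) (hr : 0 < r) (hr' : r < Real.pi / Real.sqrt δ) :
    (n : ℝ) * csDelta δ r * (∫ t in (0:ℝ)..r, snDelta δ t ^ (n - 1)) ≤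
      snDelta δ r ^ n := by
  have hsn := continuous_snDelta_of_pos hδ
  have hcs := continuous_csDelta_of_pos hδ
  have hFTC : ∫ t in (0:ℝ)..r, n * snDelta δ t ^ (n - 1) * csDelta δ t = snDelta δ r ^ n := by
    rw [integral_eq_sub_of_hasDerivAt
      (fun t _ => (hasDerivAt_snDelta_of_pos hδ t).fun_pow n)
      ((by fun_prop : Continuous _).intervalIntegrable _ _)]
    simp [snDelta_of_pos hδ, Nat.ne_of_gt hn]
  rw [← hFTC, ← integral_const_mul]
  refine integral_mono_on hr.le ((by fun_prop : Continuous _).intervalIntegrable _ _)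
    ((by fun_prop : Continuous _).intervalIntegrable _ _) fun t ht => ?_
  have hnonneg := snDelta_nonneg_of_pos hδ ht.1 (ht.2.trans hr'.le)
  have hle := csDelta_le_csDelta_of_pos hδ ht.1 ht.2 hr'.le
  rw [mul_right_comm]
  gcongr
end

section
/- Let n ≥ 1 be an integer and δ ≤ 0 a real number, and define α_δ(r) = (∫₀^r sn_δ(t)^{n−1} dt) / sn_δ(r)^{n−1}. Then α_δ is concave on (0, ∞). (This is the concavity part of Corollary 2.6 of the paper.) -/
open Real intervalIntegral

/-- The function `α_δ(r) = (∫₀^r sn_δ(t)^{n-1} dt) / sn_δ(r)^{n-1}`. -/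
noncomputable def alphaDelta (n : ℕ) (δ r : ℝ) : ℝ :=
  (∫ t in (0:ℝ)..r, snDelta δ t ^ (n - 1)) / snDelta δ r ^ (n - 1)

/-- The derivative of a natural power as a multiple of that power, away from the zeros of `s`. -/
theorem hasDerivAt_pow_div {s : ℝ → ℝ} {s' r : ℝ} (m : ℕ) (hs : HasDerivAt s s' r)
    (h0 : s r ≠ 0) : HasDerivAt (fun t => s t ^ m) (m * s' / s r * s r ^ m) r := by
  refine (hs.fun_pow m).congr_deriv ?_
  cases m with
  | zero => simp
  | succ k =>
    simp only [Nat.add_sub_cancel, pow_succ]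
    field_simp

/-- If `s' = c`, `c' = κ s` with `κ ≥ 0` and `s` is a generalized sine, then
`(1 + m c²) ∫₀ʳ s^m ≤ s^(m+1) c`. -/
theorem integral_pow_le_of_generalized_sine {s c : ℝ → ℝ} {κ : ℝ} (m : ℕ) (hκ : 0 ≤ κ)
    (hs : ∀ t, HasDerivAt s (c t) t) (hc : ∀ t, HasDerivAt c (κ * s t) t)
    (hcs : ∀ t, c t ^ 2 = 1 + κ * s t ^ 2) (hs0 : s 0 = 0) (hpos : ∀ t, 0 < t → 0 < s t)
    {r : ℝ} (hr : 0 < r) :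
    (1 + m * c r ^ 2) * ∫ t in (0 : ℝ)..r, s t ^ m ≤ s r ^ (m + 1) * c r := by
  have hscont : Continuous s := continuous_iff_continuousAt.2 fun t => (hs t).continuousAt
  have hccont : Continuous c := continuous_iff_continuousAt.2 fun t => (hc t).continuousAt
  have hF : ∀ x, HasDerivAt (fun x => ∫ t in (0 : ℝ)..x, s t ^ m) (s x ^ m) x := fun x =>
    ((hscont.pow m).integral_hasStrictDerivAt 0 x).hasDerivAt
  have hFcont : Continuous fun x => ∫ t in (0 : ℝ)..x, s t ^ m :=
    continuous_iff_continuousAt.2 fun t => (hF t).continuousAt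
  have hden : ∀ t, 0 < 1 + (m : ℝ) * c t ^ 2 := fun t => by positivity
  have hmono : MonotoneOn
      (fun x => s x ^ (m + 1) * c x / (1 + m * c x ^ 2) - ∫ t in (0 : ℝ)..x, s t ^ m)
      (Set.Ici 0) := by
    refine monotoneOn_of_hasDerivWithinAt_nonneg (convex_Ici 0)
      (f' := fun x => 2 * κ * s x ^ 2 * s x ^ m / (1 + m * c x ^ 2) ^ 2) ?_ ?_ ?_
    · refine Continuous.continuousOn (Continuous.sub (Continuous.div ?_ ?_ ?_) hFcont)
      · fun_prop
      · fun_prop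
      · exact fun t => (hden t).ne'
    · intro x _
      have hd := (((hs x).fun_pow (m + 1)).fun_mul (hc x)).fun_div
        ((((hc x).fun_pow 2).const_mul (m : ℝ)).const_add 1) (hden x).ne'
      refine ((hd.fun_sub (hF x)).congr_deriv ?_).hasDerivWithinAt
      have hne := (hden x).ne'
      simp only [Nat.add_sub_cancel, pow_succ (s x) m]
      push_cast
      rw [div_sub' (pow_ne_zero 2 hne)]
      congr 1
      linear_combination (s x ^ m + m * c x ^ 2 * s x ^ m) * (hcs x)
    · intro x hx
      rw [interior_Ici] at hx
      have := hpos x hx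
      positivity
  have h := hmono Set.self_mem_Ici hr.le hr.le
  simp only [hs0, intervalIntegral.integral_same] at h
  simp only [ne_eq, Nat.add_eq_zero_iff, one_ne_zero, and_false, not_false_eq_true, zero_pow,
    zero_mul, zero_div, sub_zero, sub_nonneg] at h
  rwa [le_div_iff₀ (hden r), mul_comm] at h

/-- For a generalized sine `s` of curvature `-κ ≤ 0`, the quotient `(∫₀ʳ s^m) / s(r)^m` is
concave on `(0, ∞)`. -/
theorem concaveOn_integral_pow_div_of_generalized_sine {s c : ℝ → ℝ} {κ : ℝ} (m : ℕ)
    (hκ : 0 ≤ κ) (hs : ∀ t, HasDerivAt s (c t) t) (hc : ∀ t, HasDerivAt c (κ * s t) t)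
    (hcs : ∀ t, c t ^ 2 = 1 + κ * s t ^ 2) (hs0 : s 0 = 0) (hpos : ∀ t, 0 < t → 0 < s t) :
    ConcaveOn ℝ (Set.Ioi 0) fun r => (∫ t in (0 : ℝ)..r, s t ^ m) / s r ^ m := by
  have hscont : Continuous s := continuous_iff_continuousAt.2 fun t => (hs t).continuousAt
  have hF : ∀ x, HasDerivAt (fun x => ∫ t in (0 : ℝ)..x, s t ^ m) (s x ^ m) x := fun x =>
    ((hscont.pow m).integral_hasStrictDerivAt 0 x).hasDerivAt
  have hA : ∀ x, 0 < x → HasDerivAt (fun r => (∫ t in (0 : ℝ)..r, s t ^ m) / s r ^ m)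
      (1 - m * (c x / s x * ((∫ t in (0 : ℝ)..x, s t ^ m) / s x ^ m))) x := by
    intro x hx
    have hsx := (hpos x hx).ne'
    refine ((hF x).fun_div (hasDerivAt_pow_div m (hs x) hsx) (pow_ne_zero m hsx)).congr_deriv ?_
    field_simp
  refine concaveOn_of_hasDerivWithinAt2_nonpos (convex_Ioi 0)
    (f' := fun x => 1 - m * (c x / s x * ((∫ t in (0 : ℝ)..x, s t ^ m) / s x ^ m)))
    (f'' := fun x => m * ((1 + m * c x ^ 2) * (∫ t in (0 : ℝ)..x, s t ^ m)
      - s x ^ (m + 1) * c x) / (s x ^ 2 * s x ^ m))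
    (fun x hx => (hA x hx).continuousAt.continuousWithinAt) ?_ ?_ ?_
  · intro x hx
    rw [interior_Ioi] at hx
    exact (hA x hx).hasDerivWithinAt
  · intro x hx
    rw [interior_Ioi] at hx
    have hsx := (hpos x hx).ne'
    refine ((((((hc x).fun_div (hs x) hsx).fun_mul (hA x hx)).const_mul (m : ℝ)).const_sub
      1).congr_deriv ?_).hasDerivWithinAt
    simp only [pow_succ (s x) m]
    field_simp
    linear_combination m * (∫ t in (0 : ℝ)..x, s t ^ m) * hcs x
  · intro x hx
    rw [interior_Ioi] at hx
    have hsx := hpos x hx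
    have h := integral_pow_le_of_generalized_sine m hκ hs hc hcs hs0 hpos hx
    exact div_nonpos_of_nonpos_of_nonneg
      (mul_nonpos_of_nonneg_of_nonpos m.cast_nonneg (sub_nonpos.2 h)) (by positivity)

/-- Concavity part of Corollary 2.6: for `δ ≤ 0`, `α_δ` is concave on `(0, ∞)`. -/
theorem alphaDelta_concaveOn (n : ℕ) (hn : 1 ≤ n) (δ : ℝ) (hδ : δ ≤ 0) :
    ConcaveOn ℝ (Set.Ioi 0) (alphaDelta n δ) := by
  rcases hδ.eq_or_lt with rfl | hneg
  · have hsn : snDelta 0 = fun t => t := by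
      funext t
      simp [snDelta]
    unfold alphaDelta
    rw [hsn]
    exact concaveOn_integral_pow_div_of_generalized_sine (c := fun _ => 1) (n - 1) le_rfl
      hasDerivAt_id' (fun t => (hasDerivAt_const t (1 : ℝ)).congr_deriv (by simp)) (by simp) rfl
      (fun _ h => h)
  · have hsn : snDelta δ = fun t => Real.sinh (√(-δ) * t) / √(-δ) := by
      funext t
      simp [snDelta, hδ.not_gt, hneg.ne]
    have hk : 0 < √(-δ) := Real.sqrt_pos.2 (neg_pos.2 hneg)
    unfold alphaDelta
    rw [hsn]
    refine concaveOn_integral_pow_div_of_generalized_sine (κ := √(-δ) ^ 2)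
      (c := fun t => Real.cosh (√(-δ) * t)) (n - 1) (sq_nonneg _) (fun t => ?_) (fun t => ?_)
      (fun t => ?_) (by simp) (fun t ht => ?_)
    · refine ((((hasDerivAt_id' t).const_mul √(-δ)).sinh).div_const √(-δ)).congr_deriv ?_
      field_simp
    · refine (((hasDerivAt_id' t).const_mul √(-δ)).cosh).congr_deriv ?_
      field_simp
    · rw [Real.cosh_sq]
      field_simp
      ring
    · exact div_pos (Real.sinh_pos_iff.2 (mul_pos hk ht)) hk
end

section
/- Let n ≥ 1 be an integer and δ > 0 a real number, and define α_δ(r) = (∫₀^r sn_δ(t)^{n−1} dt) / sn_δ(r)^{n−1}. Then α_δ is convex on the interval (0, π/√δ). (This is the convexity part of Corollary 2.6 of the paper.) -/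
open Real intervalIntegral

/-- If `s' = c`, `c' = -δ s` and `c² + δ s² = 1` with `s 0 = 0` and `s ≥ 0` on `[0, r]`, then
`∫₀^r s^m` is bounded below by `c s^{m+1} / (1 + m c²)` at `r`. -/
lemma div_le_integral_pow_of_hasDerivAt {s c : ℝ → ℝ} {δ : ℝ} (hδ : 0 < δ)
    (hs : ∀ t, HasDerivAt s (c t) t) (hc : ∀ t, HasDerivAt c (-δ * s t) t)
    (hsc : ∀ t, c t ^ 2 + δ * s t ^ 2 = 1) (hs0 : s 0 = 0) (m : ℕ) {r : ℝ} (hr : 0 ≤ r)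
    (hpos : ∀ t ∈ Set.Icc 0 r, 0 ≤ s t) :
    c r * s r ^ (m + 1) / (1 + m * c r ^ 2) ≤ ∫ t in (0:ℝ)..r, s t ^ m := by
  have hcont : Continuous fun t => s t ^ m :=
    (continuous_iff_continuousAt.2 fun t => (hs t).continuousAt).pow m
  have hD : ∀ t, 0 < 1 + m * c t ^ 2 := fun t => by positivity
  have hG : ∀ t, HasDerivAt
      (fun r => (∫ t in (0:ℝ)..r, s t ^ m) - c r * s r ^ (m + 1) / (1 + m * c r ^ 2))
      (2 * δ * s t ^ m * s t ^ 2 / (1 + m * c t ^ 2) ^ 2) t := by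
    intro t
    have hF := hcont.integral_hasStrictDerivAt 0 t |>.hasDerivAt
    have hden : HasDerivAt (fun r => 1 + m * c r ^ 2) _ t :=
      (((hc t).pow 2).const_mul (m : ℝ)).const_add 1
    have hnum : HasDerivAt (fun r => c r * s r ^ (m + 1)) _ t := (hc t).mul ((hs t).pow (m + 1))
    refine (hF.sub (hnum.div hden (hD t).ne')).congr_deriv ?_
    have hDt := (hD t).ne'
    have hδs : δ * s t ^ 2 = 1 - c t ^ 2 := by linarith [hsc t]
    rw [eq_div_iff (by positivity), sub_mul, div_mul_cancel₀ _ (by positivity)]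
    simp only [Nat.cast_add, Nat.cast_one, Nat.cast_ofNat,
      pow_one, pow_succ (s t) m, Nat.add_one_sub_one]
    linear_combination (s t ^ m * (1 + m * c t ^ 2) - 2 * m * c t ^ 2 * s t ^ m - 2 * s t ^ m) * hδs
  have hmono : MonotoneOn
      (fun r => (∫ t in (0:ℝ)..r, s t ^ m) - c r * s r ^ (m + 1) / (1 + m * c r ^ 2))
      (Set.Icc 0 r) := by
    refine monotoneOn_of_hasDerivWithinAt_nonneg (convex_Icc 0 r)
      (fun t _ => (hG t).continuousAt.continuousWithinAt)
      (fun t _ => (hG t).hasDerivWithinAt) fun t ht => ?_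
    have := hpos t (interior_subset ht)
    positivity
  have h := hmono (Set.left_mem_Icc.2 hr) (Set.right_mem_Icc.2 hr) hr
  simpa [hs0] using h

/-- If `s' = c`, `c' = -δ s` and `c² + δ s² = 1` with `s 0 = 0` and `s > 0` on `(0, L)`, then
`r ↦ (∫₀^r s^m) / s(r)^m` is convex on `(0, L)`. -/
lemma convexOn_integral_pow_div_pow {s c : ℝ → ℝ} {δ L : ℝ} (hδ : 0 < δ)
    (hs : ∀ t, HasDerivAt s (c t) t) (hc : ∀ t, HasDerivAt c (-δ * s t) t)
    (hsc : ∀ t, c t ^ 2 + δ * s t ^ 2 = 1) (hs0 : s 0 = 0)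
    (hpos : ∀ t ∈ Set.Ioo 0 L, 0 < s t) (m : ℕ) :
    ConvexOn ℝ (Set.Ioo 0 L) fun r => (∫ t in (0:ℝ)..r, s t ^ m) / s r ^ m := by
  have hcont : Continuous fun t => s t ^ m :=
    (continuous_iff_continuousAt.2 fun t => (hs t).continuousAt).pow m
  have h1 : ∀ r ∈ Set.Ioo 0 L, HasDerivAt (fun r => (∫ t in (0:ℝ)..r, s t ^ m) / s r ^ m)
      (1 - m * ((∫ t in (0:ℝ)..r, s t ^ m) / s r ^ m * (c r / s r))) r := by
    intro r hr
    have hsr := (hpos r hr).ne'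
    have hF := hcont.integral_hasStrictDerivAt 0 r |>.hasDerivAt
    refine (hF.div ((hs r).pow m) (pow_ne_zero m hsr)).congr_deriv ?_
    rcases m with _ | k
    · simp
    · simp only [Pi.pow_apply, Nat.add_sub_cancel]
      field_simp
      ring
  have h2 : ∀ r ∈ Set.Ioo 0 L, HasDerivAt
      (fun r => 1 - m * ((∫ t in (0:ℝ)..r, s t ^ m) / s r ^ m * (c r / s r)))
      (m / s r ^ 2 * ((∫ t in (0:ℝ)..r, s t ^ m) / s r ^ m * (1 + m * c r ^ 2) - c r * s r)) r := by
    intro r hr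
    have hsr := (hpos r hr).ne'
    refine ((((h1 r hr).mul ((hc r).div (hs r) hsr)).const_mul (m : ℝ)).const_sub 1).congr_deriv ?_
    simp only [Pi.div_apply]
    generalize (∫ t in (0:ℝ)..r, s t ^ m) / s r ^ m = a
    field_simp
    linear_combination (m * a) * hsc r
  refine convexOn_of_hasDerivWithinAt2_nonneg (convex_Ioo 0 L)
    (f' := fun r => 1 - m * ((∫ t in (0:ℝ)..r, s t ^ m) / s r ^ m * (c r / s r)))
    (f'' := fun r => m / s r ^ 2 *
      ((∫ t in (0:ℝ)..r, s t ^ m) / s r ^ m * (1 + m * c r ^ 2) - c r * s r))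
    (fun r hr => (h1 r hr).continuousAt.continuousWithinAt)
    (fun r hr => (h1 r (interior_subset hr)).hasDerivWithinAt)
    (fun r hr => (h2 r (interior_subset hr)).hasDerivWithinAt) fun r hr => ?_
  replace hr := interior_subset hr
  have hsr := hpos r hr
  have hle := div_le_integral_pow_of_hasDerivAt hδ hs hc hsc hs0 m hr.1.le fun t ht => by
    rcases ht.1.eq_or_lt with rfl | h0
    · exact hs0.ge
    · exact (hpos t ⟨h0, ht.2.trans_lt hr.2⟩).le
  refine mul_nonneg (by positivity) (sub_nonneg.2 ?_)
  rw [div_le_iff₀ (by positivity)] at hle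
  rw [div_mul_eq_mul_div, le_div_iff₀ (by positivity)]
  linarith [pow_succ (s r) m, show c r * s r * s r ^ m = c r * s r ^ (m + 1) by ring]

/-- Convexity part of Corollary 2.6: for `δ > 0`, `α_δ` is convex on `(0, π/√δ)`. -/
theorem alphaDelta_convexOn (n : ℕ) (hn : 1 ≤ n) (δ : ℝ) (hδ : 0 < δ) :
    ConvexOn ℝ (Set.Ioo 0 (Real.pi / Real.sqrt δ)) (alphaDelta n δ) := by
  have hq : 0 < √δ := Real.sqrt_pos.2 hδ
  have hsn : ∀ t, snDelta δ t = Real.sin (√δ * t) / √δ := fun t => if_pos hδ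
  have hlin : ∀ t, HasDerivAt (fun t => √δ * t) √δ t := fun t => by
    simpa using (hasDerivAt_id t).const_mul √δ
  refine convexOn_integral_pow_div_pow (s := snDelta δ) (c := fun t => Real.cos (√δ * t)) hδ
    ?_ ?_ ?_ ?_ ?_ (n - 1)
  · intro t
    rw [funext hsn]
    exact ((hlin t).sin.div_const √δ).congr_deriv (by field_simp)
  · intro t
    refine (hlin t).cos.congr_deriv ?_
    rw [hsn]
    field_simp
    rw [Real.sq_sqrt hδ.le]
    ring
  · intro t
    rw [hsn, div_pow, Real.sq_sqrt hδ.le, mul_div_cancel₀ _ hδ.ne', Real.cos_sq_add_sin_sq]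
  · simp [hsn]
  · intro t ht
    rw [hsn]
    refine div_pos (Real.sin_pos_of_pos_of_lt_pi (mul_pos hq ht.1) ?_) hq
    rw [mul_comm]
    exact (lt_div_iff₀ hq).1 ht.2
end

section
/- Let n ≥ 1 be an integer. Then for every r ∈ [0, π] the quantity ω(r) = (sin r)^n·cos r − (n−1)·(cos r)^2·∫₀^r (sin t)^{n−1} dt − ∫₀^r (sin t)^{n−1} dt is nonpositive, i.e. ω(r) ≤ 0. (This is the key claim in the proof of convexity of α₁ in Corollary 2.6 of the paper.) -/
open Real intervalIntegral

/-- The derivative of `∫₀^r sin^m - sin^(m+1) r cos r / (1 + m cos² r)` is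
`2 sin^(m+2) r / (1 + m cos² r)²`. -/
theorem hasDerivAt_integral_sin_pow_sub_div (m : ℕ) (r : ℝ) :
    HasDerivAt
      (fun r => (∫ t in (0:ℝ)..r, Real.sin t ^ m)
        - Real.sin r ^ (m + 1) * Real.cos r / (1 + m * Real.cos r ^ 2))
      (2 * Real.sin r ^ (m + 2) / (1 + m * Real.cos r ^ 2) ^ 2) r := by
  have hD : 1 + (m : ℝ) * Real.cos r ^ 2 ≠ 0 := by positivity
  have hI : HasDerivAt (fun r => ∫ t in (0:ℝ)..r, Real.sin t ^ m) (Real.sin r ^ m) r :=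
    (Real.continuous_sin.pow m).integral_hasStrictDerivAt 0 r |>.hasDerivAt
  have hN := ((Real.hasDerivAt_sin r).fun_pow (m + 1)).fun_mul (Real.hasDerivAt_cos r)
  have hQ := (((Real.hasDerivAt_cos r).fun_pow 2).const_mul (m : ℝ)).const_add 1
  refine (hI.fun_sub (hN.fun_div hQ hD)).congr_deriv ?_
  rw [eq_div_iff (pow_ne_zero 2 hD), sub_mul, div_mul_cancel₀ _ (pow_ne_zero 2 hD)]
  simp only [Nat.add_sub_cancel]
  push_cast
  have hsin : Real.sin r ^ (m + 2) = Real.sin r ^ m * (1 - Real.cos r ^ 2) := by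
    rw [pow_add, Real.sin_sq]
  have hmul : Real.sin r ^ (m + 1) * Real.sin r = Real.sin r ^ (m + 2) := by ring
  rw [hsin] at hmul ⊢
  linear_combination (1 + m * Real.cos r ^ 2 - 2 * m * Real.cos r ^ 2) * hmul

/-- The key claim in the proof of convexity of `α₁` in Corollary 2.6:
for `n ≥ 1` and `r ∈ [0, π]`,
`ω(r) = (sin r)^n·cos r − (n−1)·(cos r)²·∫₀^r (sin t)^{n−1} dt − ∫₀^r (sin t)^{n−1} dt ≤ 0`. -/
theorem omega_nonpos (n : ℕ) (hn : 1 ≤ n) (r : ℝ) (hr : r ∈ Set.Icc 0 Real.pi) :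
    Real.sin r ^ n * Real.cos r
      - ((n : ℝ) - 1) * Real.cos r ^ 2 * (∫ t in (0:ℝ)..r, Real.sin t ^ (n - 1))
      - (∫ t in (0:ℝ)..r, Real.sin t ^ (n - 1)) ≤ 0 := by
  obtain ⟨m, rfl⟩ := Nat.exists_eq_add_of_le' hn
  have hmono := monotoneOn_of_deriv_nonneg (convex_Icc 0 Real.pi)
    (fun x _ => (hasDerivAt_integral_sin_pow_sub_div m x).continuousAt.continuousWithinAt)
    (fun x _ =>
      (hasDerivAt_integral_sin_pow_sub_div m x).differentiableAt.differentiableWithinAt)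
    (fun x hx => by
      rw [(hasDerivAt_integral_sin_pow_sub_div m x).deriv]
      have := Real.sin_nonneg_of_mem_Icc (interior_subset hx)
      positivity)
  have h := hmono (Set.left_mem_Icc.2 Real.pi_pos.le) hr hr.1
  have hD : 0 < 1 + (m : ℝ) * Real.cos r ^ 2 := by positivity
  simp only [integral_same, Real.sin_zero, zero_pow m.succ_ne_zero, zero_mul, zero_div, sub_zero,
    sub_nonneg, div_le_iff₀ hD] at h
  simp only [Nat.add_sub_cancel]
  push_cast
  linarith
end

section
/- Let (X, d) be a separable pseudo-metric space, r > 0 a real number, and N a positive integer such that every ball of radius 4r in X can be covered by N balls of radius r. Let μ be a finite Borel measure on X and β a real number with 0 < β < μ(X) such that μ(B(p, r)) ≤ β/2 for every p ∈ X. Then there exist bounded Borel subsets A ⊆ D of X such that β ≤ μ(A) ≤ μ(D) ≤ 2Nβ and d(x, y) ≥ 3r for every x ∈ A and every y in the complement of D. (This is Claim 3.5 of the paper, the key step toward Lemma 3.4.) -/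
open MeasureTheory Metric
open scoped ENNReal

/-- A finite set with at most `N` elements is contained in the range of a map from `Fin N`,
provided the ambient type is nonempty. -/
theorem Finset.exists_fin_map_of_card_le {X : Type*} [Nonempty X] (s : Finset X) {N : ℕ}
    (h : s.card ≤ N) : ∃ f : Fin N → X, ∀ x ∈ s, ∃ i, f i = x := by
  classical
  refine ⟨fun i ↦ if hi : (i : ℕ) < s.card then (s.equivFin.symm ⟨i, hi⟩ : X)
    else Classical.arbitrary X, fun x hx ↦ ?_⟩
  have hlt := (s.equivFin ⟨x, hx⟩).isLt
  exact ⟨⟨s.equivFin ⟨x, hx⟩, hlt.trans_le h⟩, by simp⟩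

/-- In a separable space, finite unions of balls of a fixed radius exhaust the measure. -/
theorem exists_finset_lt_measure_biUnion_ball {X : Type*} [PseudoMetricSpace X]
    [TopologicalSpace.SeparableSpace X] [Nonempty X] [MeasurableSpace X] (μ : Measure X)
    {r : ℝ} (hr : 0 < r) {b : ℝ≥0∞} (hb : b < μ Set.univ) :
    ∃ t : Finset X, b < μ (⋃ c ∈ t, ball c r) := by
  classical
  let u := TopologicalSpace.denseSeq X
  let s : ℕ → Set X := fun n ↦ ⋃ i ∈ Finset.range n, ball (u i) r
  have hs : Monotone s := fun m n hmn ↦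
    Set.biUnion_subset_biUnion_left (fun i hi ↦ Finset.range_mono hmn hi)
  have huniv : ⋃ n, s n = Set.univ := by
    refine Set.eq_univ_of_forall fun x ↦ ?_
    obtain ⟨n, hn⟩ := (TopologicalSpace.denseRange_denseSeq X).exists_dist_lt x hr
    exact Set.mem_iUnion.2 ⟨n + 1, Set.mem_biUnion (Finset.self_mem_range_succ n) hn⟩
  rw [← huniv, hs.directed_le.measure_iUnion] at hb
  obtain ⟨n, hn⟩ := lt_iSup_iff.1 hb
  exact ⟨(Finset.range n).image u, by simpa [s] using hn⟩

/-- Claim 3.5 of the paper: let `(X,d)` be a separable pseudo-metric space,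
`r > 0`, and `N` a positive integer such that every ball of radius `4r` can be
covered by `N` balls of radius `r`. If `μ` is a finite Borel measure and
`0 < β < μ(X)` satisfies `μ(B(p,r)) ≤ β/2` for all `p`, then there are bounded
Borel sets `A ⊆ D` with `β ≤ μ(A) ≤ μ(D) ≤ 2Nβ` and `d(x,y) ≥ 3r` for all
`x ∈ A` and `y ∉ D`. -/
theorem claim_aux_sets
    {X : Type*} [PseudoMetricSpace X] [TopologicalSpace.SeparableSpace X]
    [MeasurableSpace X] [BorelSpace X]
    (r : ℝ) (hr : 0 < r) (N : ℕ) (hN : 0 < N)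
    (hcover : ∀ p : X, ∃ s : Finset X, s.card ≤ N ∧
      ball p (4 * r) ⊆ ⋃ q ∈ s, ball q r)
    (μ : Measure X) [IsFiniteMeasure μ]
    (β : ℝ) (hβ : 0 < β) (hβX : ENNReal.ofReal β < μ Set.univ)
    (hsmall : ∀ p : X, μ (ball p r) ≤ ENNReal.ofReal (β / 2)) :
    ∃ A D : Set X, A ⊆ D ∧ MeasurableSet A ∧ MeasurableSet D ∧
      Bornology.IsBounded A ∧ Bornology.IsBounded D ∧
      ENNReal.ofReal β ≤ μ A ∧ μ A ≤ μ D ∧ μ D ≤ ENNReal.ofReal (2 * N * β) ∧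
      ∀ x ∈ A, ∀ y ∉ D, 3 * r ≤ dist x y := by
  classical
  have hX : Nonempty X := by
    by_contra h
    rw [not_nonempty_iff] at h
    simp [Set.univ_eq_empty_iff.2 h] at hβX
  have hcover' : ∀ p : X, ∃ f : Fin N → X, ball p (4 * r) ⊆ ⋃ i, ball (f i) r := by
    intro p
    obtain ⟨s, hs, hps⟩ := hcover p
    obtain ⟨f, hf⟩ := s.exists_fin_map_of_card_le hs
    refine ⟨f, hps.trans (Set.iUnion₂_subset fun q hq ↦ ?_)⟩
    obtain ⟨i, rfl⟩ := hf q hq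
    exact Set.subset_iUnion (fun i ↦ ball (f i) r) i
  choose f hf using hcover'
  have hex : ∃ k, ∃ t : Finset X, t.card = k ∧
      ENNReal.ofReal β ≤ μ (⋃ c ∈ t, ball c r) := by
    obtain ⟨t, ht⟩ := exists_finset_lt_measure_biUnion_ball μ hr hβX
    exact ⟨_, t, rfl, ht.le⟩
  obtain ⟨t, htk, htβ⟩ := Nat.find_spec hex
  have hmin : ∀ t' : Finset X, t'.card < t.card →
      μ (⋃ c ∈ t', ball c r) ≤ ENNReal.ofReal β := by
    intro t' ht'
    by_contra! h
    exact Nat.find_min hex (htk ▸ ht') ⟨t', rfl, h.le⟩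
  have hle : ∀ t' : Finset X, t'.card ≤ t.card →
      μ (⋃ c ∈ t', ball c r) ≤ ENNReal.ofReal (2 * β) := by
    intro t' ht'
    rcases t'.eq_empty_or_nonempty with rfl | ⟨c, hc⟩
    · simp
    · rw [← Finset.insert_erase hc, Finset.set_biUnion_insert]
      calc _ ≤ ENNReal.ofReal (β / 2) + ENNReal.ofReal β :=
            (measure_union_le _ _).trans (add_le_add (hsmall c)
              (hmin _ ((Finset.card_erase_lt_of_mem hc).trans_le ht')))
        _ ≤ ENNReal.ofReal (2 * β) := by
            rw [← ENNReal.ofReal_add (by positivity) hβ.le]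
            exact ENNReal.ofReal_le_ofReal (by linarith)
  have hAD : (⋃ c ∈ t, ball c r) ⊆ ⋃ c ∈ t, ball c (4 * r) :=
    Set.iUnion₂_mono fun c _ ↦ ball_subset_ball (by linarith)
  refine ⟨⋃ c ∈ t, ball c r, ⋃ c ∈ t, ball c (4 * r), hAD,
    t.measurableSet_biUnion fun _ _ ↦ measurableSet_ball,
    t.measurableSet_biUnion fun _ _ ↦ measurableSet_ball,
    (Bornology.isBounded_biUnion_finset t).2 fun _ _ ↦ isBounded_ball,
    (Bornology.isBounded_biUnion_finset t).2 fun _ _ ↦ isBounded_ball,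
    htβ, measure_mono hAD, ?_, ?_⟩
  · have hsub : (⋃ c ∈ t, ball c (4 * r)) ⊆
        ⋃ i, ⋃ q ∈ t.image (fun c ↦ f c i), ball q r := by
      refine Set.iUnion₂_subset fun c hc x hx ↦ ?_
      obtain ⟨i, hi⟩ := Set.mem_iUnion.1 (hf c hx)
      exact Set.mem_iUnion.2
        ⟨i, Set.mem_biUnion (Finset.mem_image_of_mem (fun c ↦ f c i) hc) hi⟩
    calc μ (⋃ c ∈ t, ball c (4 * r))
        ≤ ∑ i, μ (⋃ q ∈ t.image (fun c ↦ f c i), ball q r) :=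
          (measure_mono hsub).trans (measure_iUnion_fintype_le _ _)
      _ ≤ ∑ _i : Fin N, ENNReal.ofReal (2 * β) :=
          Finset.sum_le_sum fun i _ ↦ hle _ Finset.card_image_le
      _ = ENNReal.ofReal (2 * N * β) := by
          rw [mul_comm 2 (N : ℝ), mul_assoc, ENNReal.ofReal_mul N.cast_nonneg]
          simp
  · intro x hx y hy
    obtain ⟨c, hc, hxc⟩ := Set.mem_iUnion₂.1 hx
    have hyc : 4 * r ≤ dist y c := by
      by_contra! h
      exact hy (Set.mem_biUnion hc h)
    have := dist_triangle_left y c x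
    rw [mem_ball] at hxc
    linarith
end

section
/- Let (X, d) be a separable pseudo-metric space such that all balls B(p, r) are precompact, and let N : (1, ∞) → (0, ∞) be a small cover refinement function for (X, d). Then for any finite non-atomic Borel measure μ on X and any positive integer k there exists a collection of k bounded Borel sets A₁, …, A_k such that μ(Aᵢ) ≥ μ(X)/(c·k) for every 1 ≤ i ≤ k, where c = 64·N(1600), and one of the following two possibilities holds: (i) all the Aᵢ are annuli whose outer radii are at most one, and the doubled annuli 2A₁, …, 2A_k are pairwise disjoint; or (ii) the r₀-neighbourhoods Aᵢ^{r₀} = {x ∈ X : dist(x, Aᵢ) ≤ r₀}, with r₀ = 1/1600, are pairwise disjoint. (This is Proposition 3.2 of the paper.) -/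
open MeasureTheory Metric Filter
open scoped ENNReal Topology

/-- For a finite non-atomic measure on a space with precompact balls, the measure of a ball is
small uniformly in its centre as the radius tends to zero. -/
theorem exists_radius_forall_measure_ball_lt {X : Type*} [PseudoMetricSpace X]
    [MeasurableSpace X] [BorelSpace X]
    (hprecompact : ∀ (p : X) (t : ℝ), IsCompact (closure (ball p t)))
    (μ : Measure X) [IsFiniteMeasure μ]
    (hna : ∀ p : X, Tendsto (fun t : ℝ => μ (ball p t)) (𝓝[>] 0) (𝓝 0))
    {v : ℝ≥0∞} (hv : v ≠ 0) :
    ∃ δ : ℝ, 0 < δ ∧ ∀ p, μ (ball p δ) < v := by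
  by_contra! hcon
  have hpos : ∀ n : ℕ, (0 : ℝ) < 1 / (n + 1) := fun n => by positivity
  choose p hp using fun n : ℕ => hcon (1 / (n + 1)) (hpos n)
  have hlim : Tendsto (fun n : ℕ => μ (ball (p 0) n)ᶜ) atTop (𝓝 0) := by
    have h := tendsto_measure_iInter_atTop (μ := μ) (s := fun n : ℕ => (ball (p 0) (n : ℝ))ᶜ)
      (fun n => measurableSet_ball.compl.nullMeasurableSet)
      (fun m n hmn => Set.compl_subset_compl.2 (ball_subset_ball (by exact_mod_cast hmn)))
      ⟨0, measure_ne_top _ _⟩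
    rwa [← Set.compl_iUnion, iUnion_ball_nat, Set.compl_univ, measure_empty] at h
  obtain ⟨m, hm⟩ := (hlim.eventually (gt_mem_nhds (pos_iff_ne_zero.2 hv))).exists
  have hmem : ∀ n, p n ∈ closure (ball (p 0) ((m : ℝ) + 1)) := by
    intro n
    apply subset_closure
    by_contra hn
    have hsub : ball (p n) (1 / (n + 1)) ⊆ (ball (p 0) (m : ℝ))ᶜ := by
      intro z hz hz'
      rw [mem_ball] at hz hz' hn
      have h1 : (1 : ℝ) / (n + 1) ≤ 1 := by
        rw [div_le_one (by positivity)]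
        linarith [(Nat.cast_nonneg n : (0 : ℝ) ≤ n)]
      linarith [dist_triangle_left (p n) (p 0) z]
    exact absurd ((hp n).trans (measure_mono hsub)) (not_le.2 hm)
  obtain ⟨x, -, φ, hφ, hx⟩ := (hprecompact (p 0) ((m : ℝ) + 1)).tendsto_subseq hmem
  obtain ⟨t, ht, ht0⟩ :=
    (((hna x).eventually (gt_mem_nhds (pos_iff_ne_zero.2 hv))).and self_mem_nhdsWithin).exists
  have ht0 : 0 < t := ht0
  have h1 : ∀ᶠ n in atTop, dist (p (φ n)) x < t / 2 :=
    hx.eventually (ball_mem_nhds x (half_pos ht0))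
  have h2 : ∀ᶠ n in atTop, (1 : ℝ) / ((φ n : ℕ) + 1) < t / 2 :=
    (tendsto_one_div_add_atTop_nhds_zero_nat.comp hφ.tendsto_atTop).eventually
      (gt_mem_nhds (half_pos ht0))
  obtain ⟨n, hn1, hn2⟩ := (h1.and h2).exists
  have hsub : ball (p (φ n)) (1 / ((φ n : ℕ) + 1)) ⊆ ball x t :=
    ball_subset_ball' (by linarith)
  exact absurd ((hp _).trans (measure_mono hsub)) (not_le.2 ht)

/-- A set covered by finitely many sets of measure at most `v` outside `G` has measure at most
the number of these sets times `v` outside `G`. -/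
theorem measure_diff_le_of_subset_iUnion {X ι : Type*} [MeasurableSpace X] (μ : Measure X)
    [Fintype ι] {S G : Set X} {f : ι → Set X} {v : ℝ≥0∞} (hS : S ⊆ ⋃ i, f i)
    (hf : ∀ i, μ (f i \ G) ≤ v) : μ (S \ G) ≤ Fintype.card ι * v := by
  have hsub : S \ G ⊆ ⋃ i, f i \ G := by
    rw [← Set.iUnion_sdiff]
    exact Set.sdiff_subset_sdiff_left hS
  calc μ (S \ G) ≤ ∑ i, μ (f i \ G) := (measure_mono hsub).trans (measure_iUnion_fintype_le _ _)
    _ ≤ ∑ _i : ι, v := Finset.sum_le_sum fun i _ => hf i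
    _ = Fintype.card ι * v := by simp

/-- If every ball of radius `r` has measure at most `v` and balls of radius `4 * r` are covered
by `n` balls of radius `r`, then outside a set `G` carrying not too much mass one finds a set of
measure at least `v` whose `3 * r`-neighbourhood has measure at most `2 * n * v`. -/
theorem exists_heavy_set_with_light_neighborhood {X : Type*} [PseudoMetricSpace X]
    [TopologicalSpace.SeparableSpace X] [MeasurableSpace X] [BorelSpace X]
    (ν : Measure X) [IsFiniteMeasure ν] {r : ℝ} (hr : 0 < r) {n : ℕ} {v : ℝ≥0∞}
    (hcov : ∀ p : X, ∃ f : Fin n → X, ball p (4 * r) ⊆ ⋃ i, ball (f i) r)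
    (hsmall : ∀ p, ν (ball p r) ≤ v) {G : Set X} (hG : v < ν Gᶜ) (hGm : MeasurableSet G) :
    ∃ A G' : Set X, MeasurableSet A ∧ Bornology.IsBounded A ∧ v ≤ ν A ∧ Disjoint A G ∧
      MeasurableSet G' ∧ G ⊆ G' ∧ (∀ a ∈ A, ball a (3 * r) ⊆ G') ∧
      ν G' ≤ ν G + n * (2 * v) := by
  classical
  have hX : Nonempty X := by
    by_contra h
    rw [not_nonempty_iff] at h
    simp [Set.eq_empty_of_isEmpty] at hG
  have hex : ∃ m : ℕ, ∃ s : Finset X, s.card ≤ m ∧ v ≤ ν ((⋃ q ∈ s, ball q r) \ G) := by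
    let d := TopologicalSpace.denseSeq X
    let U : ℕ → Set X := fun j => (⋃ q ∈ (Finset.range j).image d, ball q r) \ G
    have hmono : Monotone U := by
      intro i j hij
      apply Set.sdiff_subset_sdiff_left
      apply Set.biUnion_subset_biUnion_left
      intro q hq
      exact Finset.image_subset_image (Finset.range_subset_range.2 hij) hq
    have hU : ⋃ j, U j = Gᶜ := by
      ext z
      simp only [Set.mem_iUnion, Set.mem_compl_iff]
      constructor
      · rintro ⟨j, hj⟩
        exact hj.2
      · intro hz
        obtain ⟨i, hi⟩ := (TopologicalSpace.denseRange_denseSeq X).exists_dist_lt z hr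
        refine ⟨i + 1, ?_, hz⟩
        simp only [Set.mem_iUnion]
        exact ⟨d i, Finset.mem_image_of_mem d (Finset.self_mem_range_succ i), hi⟩
    have hlim := tendsto_measure_iUnion_atTop (μ := ν) hmono
    rw [hU] at hlim
    obtain ⟨j, hj⟩ := (hlim.eventually (lt_mem_nhds hG)).exists
    exact ⟨_, _, le_rfl, hj.le⟩
  obtain ⟨s, hs, hsv⟩ := Nat.find_spec hex
  set m := Nat.find hex with hm
  have hgroup : ∀ u : Finset X, u.card ≤ m → ν ((⋃ q ∈ u, ball q r) \ G) ≤ 2 * v := by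
    intro u hu
    rcases u.eq_empty_or_nonempty with rfl | ⟨a, ha⟩
    · simp
    · have hcard := Finset.card_erase_add_one ha
      have hlt : ν ((⋃ q ∈ u.erase a, ball q r) \ G) < v := by
        by_contra! h
        exact Nat.find_min hex (m := (u.erase a).card) (by omega) ⟨_, le_rfl, h⟩
      have hsub : (⋃ q ∈ u, ball q r) \ G ⊆ ball a r ∪ (⋃ q ∈ u.erase a, ball q r) \ G := by
        rintro z ⟨hz, hzG⟩
        simp only [Set.mem_iUnion] at hz
        obtain ⟨q, hq, hzq⟩ := hz
        by_cases hqa : q = a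
        · exact Or.inl (hqa ▸ hzq)
        · refine Or.inr ⟨?_, hzG⟩
          simp only [Set.mem_iUnion]
          exact ⟨q, Finset.mem_erase.2 ⟨hqa, hq⟩, hzq⟩
      calc _ ≤ _ := measure_mono hsub
        _ ≤ _ := measure_union_le _ _
        _ ≤ v + v := add_le_add (hsmall a) hlt.le
        _ = 2 * v := (two_mul v).symm
  choose f hf using hcov
  have hS : (⋃ q ∈ s, ball q (4 * r)) ⊆ ⋃ i : Fin n, ⋃ q ∈ s.image (fun q => f q i), ball q r := by
    intro z hz
    simp only [Set.mem_iUnion] at hz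
    obtain ⟨q, hq, hzq⟩ := hz
    obtain ⟨i, hi⟩ := Set.mem_iUnion.1 (hf q hzq)
    simp only [Set.mem_iUnion]
    exact ⟨i, f q i, Finset.mem_image_of_mem (fun q => f q i) hq, hi⟩
  have hSG := measure_diff_le_of_subset_iUnion ν (G := G) hS
    (fun i => hgroup _ (Finset.card_image_le.trans hs))
  have hmeas : ∀ t : ℝ, MeasurableSet (⋃ q ∈ s, ball q t) := fun t =>
    Finset.measurableSet_biUnion _ fun _ _ => measurableSet_ball
  refine ⟨(⋃ q ∈ s, ball q r) \ G, G ∪ ⋃ q ∈ s, ball q (4 * r), (hmeas r).diff hGm,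
    ?_, hsv, Set.disjoint_sdiff_left, hGm.union (hmeas _), Set.subset_union_left, ?_, ?_⟩
  · refine Bornology.IsBounded.subset ?_ Set.sdiff_subset
    exact (Bornology.isBounded_biUnion_finset s).2 fun _ _ => isBounded_ball
  · rintro a ⟨ha, -⟩ z hz
    simp only [Set.mem_iUnion] at ha
    obtain ⟨q, hq, haq⟩ := ha
    right
    simp only [Set.mem_iUnion]
    refine ⟨q, hq, ?_⟩
    rw [mem_ball] at *
    linarith [dist_triangle z a q]
  · rw [← Set.union_sdiff_self]
    refine (measure_union_le _ _).trans ?_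
    gcongr
    simpa using hSG

/-- If every ball of radius `r` has measure at most `v`, a measure of total mass more than
`k * (2 * n * v) + v` charges `k` sets at mutual distance at least `3 * r` with mass `v`. -/
theorem exists_separated_heavy_sets {X : Type*} [PseudoMetricSpace X]
    [TopologicalSpace.SeparableSpace X] [MeasurableSpace X] [BorelSpace X]
    (ν : Measure X) [IsFiniteMeasure ν] {r : ℝ} (hr : 0 < r) {n : ℕ} {v : ℝ≥0∞}
    (hcov : ∀ p : X, ∃ f : Fin n → X, ball p (4 * r) ⊆ ⋃ i, ball (f i) r)
    (hsmall : ∀ p, ν (ball p r) ≤ v) (k : ℕ) (hk : k * (n * (2 * v)) + v < ν Set.univ) :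
    ∃ A : Fin k → Set X, (∀ i, MeasurableSet (A i) ∧ Bornology.IsBounded (A i) ∧ v ≤ ν (A i)) ∧
      Pairwise fun i j => ∀ x ∈ A i, ∀ y ∈ A j, 3 * r ≤ dist x y := by
  suffices h : ∀ j ≤ k, ∃ (l : List (Set X)) (G : Set X), l.length = j ∧ MeasurableSet G ∧
      ν G ≤ j * (n * (2 * v)) ∧
      (∀ A ∈ l, (MeasurableSet A ∧ Bornology.IsBounded A ∧ v ≤ ν A) ∧
        ∀ a ∈ A, ball a (3 * r) ⊆ G) ∧
      l.Pairwise fun A B => ∀ x ∈ A, ∀ y ∈ B, 3 * r ≤ dist x y by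
    obtain ⟨l, G, hl, -, -, hA, hp⟩ := h k le_rfl
    subst hl
    refine ⟨l.get, fun i => (hA _ (l.get_mem i)).1, ?_⟩
    intro i j hij
    rw [List.pairwise_iff_get] at hp
    rcases lt_or_gt_of_ne hij with h | h
    · exact hp i j h
    · intro x hx y hy
      rw [dist_comm]
      exact hp j i h y hy x hx
  intro j hj
  induction j with
  | zero => exact ⟨[], ∅, rfl, MeasurableSet.empty, by simp, by simp, by simp⟩
  | succ j ih =>
    obtain ⟨l, G, hl, hGm, hG, hA, hp⟩ := ih (by omega)
    have hGc : v < ν Gᶜ := by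
      by_contra! h
      refine absurd hk (not_lt.2 ?_)
      rw [← measure_add_measure_compl hGm]
      refine add_le_add (hG.trans ?_) h
      gcongr
      omega
    obtain ⟨A, G', hAm, hAb, hAv, hAG, hGm', hGG', hAG', hG'⟩ :=
      exists_heavy_set_with_light_neighborhood ν hr hcov hsmall hGc hGm
    refine ⟨A :: l, G', by simp [hl], hGm', ?_, ?_, ?_⟩
    · refine hG'.trans ?_
      push_cast
      rw [add_mul, one_mul]
      gcongr
    · intro B hB
      rcases List.mem_cons.1 hB with rfl | hB
      · exact ⟨⟨hAm, hAb, hAv⟩, hAG'⟩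
      · exact ⟨(hA B hB).1, fun a ha => ((hA B hB).2 a ha).trans hGG'⟩
    · refine List.pairwise_cons.2 ⟨fun B hB x hx y hy => ?_, hp⟩
      by_contra! hlt
      exact Set.disjoint_left.1 hAG hx ((hA B hB).2 y hy hlt)

/-- The annulus with centre `a`, inner radius `r` and outer radius `R`. -/
def annulus {X : Type*} [PseudoMetricSpace X] (a : X) (r R : ℝ) : Set X :=
  {x : X | r ≤ dist x a ∧ dist x a < R}

theorem measurableSet_annulus {X : Type*} [PseudoMetricSpace X] [MeasurableSpace X]
    [BorelSpace X] (a : X) (r R : ℝ) : MeasurableSet (annulus a r R) := by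
  have h : annulus a r R = ball a R \ ball a r := by
    ext x
    simp [annulus, and_comm]
  exact h ▸ measurableSet_ball.diff measurableSet_ball

theorem isBounded_annulus {X : Type*} [PseudoMetricSpace X] (a : X) (r R : ℝ) :
    Bornology.IsBounded (annulus a r R) :=
  isBounded_ball.subset fun _ hx => mem_ball.2 hx.2

/-- A family `l` of annuli `(a, r, R)` of measure at least `v` with pairwise disjoint doubles,
together with balls `(y, ρ)` in a list `C` which cover all the doubles and whose dilations lie in
a set `F` of controlled measure. The number `t` counts the steps of the construction, each of which
adds measure at most `w` to `F`. -/
structure AnnulusConfig {X : Type*} [PseudoMetricSpace X] [MeasurableSpace X] (μ : Measure X)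
    (v w : ℝ≥0∞) (F : Set X) (l : List (X × ℝ × ℝ)) (C : List (X × ℝ)) (t : ℕ) : Prop where
  measurableSet : MeasurableSet F
  valid : ∀ A ∈ l, 0 ≤ A.2.1 ∧ A.2.1 < A.2.2 ∧ A.2.2 ≤ 1 ∧ v ≤ μ (annulus A.1 A.2.1 A.2.2)
  disjoint : l.Pairwise fun A B =>
    Disjoint (annulus A.1 (A.2.1 / 2) (2 * A.2.2)) (annulus B.1 (B.2.1 / 2) (2 * B.2.2))
  covered : ∀ A ∈ l, ∀ z ∈ annulus A.1 (A.2.1 / 2) (2 * A.2.2), ∃ c ∈ C, dist z c.1 < c.2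
  removed : ∀ c ∈ C, ball c.1 (13 * c.2) ⊆ F
  count : t + C.length ≤ 2 * l.length
  mass : μ F ≤ t * w

namespace AnnulusConfig

variable {X : Type*} [PseudoMetricSpace X] [MeasurableSpace X] {μ : Measure X} {v w : ℝ≥0∞}
  {F : Set X} {l : List (X × ℝ × ℝ)} {C : List (X × ℝ)} {t : ℕ}

theorem nil : AnnulusConfig μ v w ∅ [] [] 0 where
  measurableSet := MeasurableSet.empty
  valid := by simp
  disjoint := by simp
  covered := by simp
  removed := by simp
  count := by simp
  mass := by simp

/-- One step of the construction: a ball of radius `s` which is heavy outside `F` yields a new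
annulus or merges at least two of the covering balls. -/
theorem step [BorelSpace X] (h : AnnulusConfig μ v w F l C t) (hv : v ≠ 0) {s : ℝ}
    (hs0 : 0 < s) (hs : s ≤ 1 / 1600) (hw : ∀ p, μ (ball p (800 * s) \ F) ≤ w) {x : X}
    (hx : v ≤ μ (ball x s \ F)) :
    ∃ F' l' C', F ⊆ F' ∧ AnnulusConfig μ v w F' l' C' (t + 1) := by
  classical
  have hmass : ∀ c, μ (F ∪ ball c (800 * s)) ≤ ((t + 1 : ℕ) : ℝ≥0∞) * w := by
    intro c
    rw [← Set.union_sdiff_self]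
    refine (measure_union_le _ _).trans ?_
    push_cast
    rw [add_mul, one_mul]
    exact add_le_add h.mass (hw c)
  have hmeas : ∀ c, MeasurableSet (F ∪ ball c (800 * s)) := fun c =>
    h.measurableSet.union measurableSet_ball
  have hdil : ∀ (c : X) (ρ : ℝ), ρ ≤ 13 * s → ball c (13 * ρ) ⊆ F ∪ ball c (800 * s) :=
    fun c ρ hρ => (ball_subset_ball (by linarith)).trans Set.subset_union_right
  have hrem : ∀ c, ∀ b ∈ C, ball b.1 (13 * b.2) ⊆ F ∪ ball c (800 * s) := fun c b hb =>
    (h.removed b hb).trans Set.subset_union_left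
  let near : ℝ → X × ℝ → Prop := fun D c => ∃ z, dist z x < D * s ∧ dist z c.1 < c.2
  have hnear : ∀ c ∈ C, near 11 c → c.2 < s := by
    rintro c hc ⟨z, hzx, hzc⟩
    by_contra! hle
    have hne : (ball x s \ F).Nonempty := by
      rw [Set.nonempty_iff_ne_empty]
      intro he
      rw [he, measure_empty] at hx
      exact hv (le_zero_iff.1 hx)
    obtain ⟨u, hu, huF⟩ := hne
    refine huF (h.removed c hc ?_)
    rw [mem_ball] at hu ⊢
    linarith [dist_triangle u x c.1, dist_triangle_left x c.1 z]
  have hlen : (C.filter fun c => near 11 c).length + (C.filter fun c => ¬ near 11 c).length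
      = C.length := by
    have := List.length_eq_length_filter_add (l := C) (fun c => decide (near 11 c))
    simpa using this.symm
  have hcount := h.count
  by_cases hmerge : 2 ≤ (C.filter fun c => near 11 c).length
  · refine ⟨F ∪ ball x (800 * s), l, (x, 13 * s) :: C.filter fun c => ¬ near 11 c,
      Set.subset_union_left, hmeas x, h.valid, h.disjoint, ?_, ?_, ?_, hmass x⟩
    · intro A hA z hz
      obtain ⟨c, hc, hzc⟩ := h.covered A hA z hz
      by_cases hn : near 11 c
      · refine ⟨_, List.mem_cons_self, ?_⟩
        have hcs := hnear c hc hn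
        obtain ⟨u, hux, huc⟩ := hn
        change dist z x < 13 * s
        linarith [dist_triangle z c.1 x, dist_triangle_left c.1 x u]
      · exact ⟨c, List.mem_cons_of_mem _ (List.mem_filter.2 ⟨hc, by simpa using hn⟩), hzc⟩
    · intro c hc
      rcases List.mem_cons.1 hc with rfl | hc
      · exact hdil _ _ le_rfl
      · exact hrem x c (List.mem_filter.1 hc).1
    · simp only [List.length_cons]
      omega
  · by_cases hleaf : ∃ c ∈ C, near 2 c
    · obtain ⟨⟨y, ρ⟩, hyC, hy⟩ := hleaf
      have hy11 : near 11 (y, ρ) := by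
        obtain ⟨z, hz, hz'⟩ := hy
        exact ⟨z, by linarith, hz'⟩
      have hρs : ρ < s := hnear _ hyC hy11
      have hyx : dist y x < 2 * s + ρ := by
        obtain ⟨z, hzx, hzy⟩ := hy
        linarith [dist_triangle_left y x z]
      have hρ : 0 < ρ := by
        obtain ⟨z, -, hzy⟩ := hy
        exact dist_nonneg.trans_lt hzy
      have hmemy : (y, ρ) ∈ C.filter fun c => near 11 c :=
        List.mem_filter.2 ⟨hyC, by simpa using hy11⟩
      have huniq : ∀ c ∈ C, near 11 c → c = (y, ρ) := by
        intro c hc hcn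
        have hmem : c ∈ C.filter fun c => near 11 c :=
          List.mem_filter.2 ⟨hc, by simpa using hcn⟩
        generalize C.filter (fun c => near 11 c) = L at hmerge hmem hmemy
        match L, hmerge, hmem, hmemy with
        | [a], _, h1, h2 => simp_all
        | _ :: _ :: _, hm, _, _ => simp at hm
      have hpos : 0 < (C.filter fun c => near 11 c).length := List.length_pos_of_mem hmemy
      refine ⟨F ∪ ball y (800 * s), (y, 2 * ρ, 4 * s) :: l,
        (y, 8 * s) :: C.filter fun c => ¬ near 11 c,
        Set.subset_union_left, hmeas y, ?_, ?_, ?_, ?_, ?_, hmass y⟩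
      · intro A hA
        rcases List.mem_cons.1 hA with rfl | hA
        · refine ⟨by simp only; linarith, by simp only; linarith, by simp only; linarith, ?_⟩
          refine hx.trans (measure_mono ?_)
          rintro z ⟨hzx, hzF⟩
          rw [mem_ball] at hzx
          constructor
          · by_contra! hlt
            refine hzF (h.removed _ hyC (mem_ball.2 ?_))
            simp only at hlt ⊢
            linarith
          · simp only
            linarith [dist_triangle_right z y x]
        · exact h.valid A hA
      · refine List.pairwise_cons.2 ⟨fun B hB => Set.disjoint_left.2 ?_, h.disjoint⟩
        rintro z ⟨hz1, hz2⟩ hzB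
        simp only at hz1 hz2
        obtain ⟨c, hc, hzc⟩ := h.covered B hB z hzB
        have hcy : c = (y, ρ) := huniq c hc ⟨z, by linarith [dist_triangle z y x], hzc⟩
        subst hcy
        simp only at hzc
        linarith
      · intro A hA z hz
        rcases List.mem_cons.1 hA with rfl | hA
        · refine ⟨_, List.mem_cons_self, ?_⟩
          have := hz.2
          simp only at this ⊢
          linarith
        · obtain ⟨c, hc, hzc⟩ := h.covered A hA z hz
          by_cases hn : near 11 c
          · refine ⟨_, List.mem_cons_self, ?_⟩
            have := huniq c hc hn
            subst this
            simp only at hzc ⊢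
            linarith
          · exact ⟨c, List.mem_cons_of_mem _ (List.mem_filter.2 ⟨hc, by simpa using hn⟩), hzc⟩
      · intro c hc
        rcases List.mem_cons.1 hc with rfl | hc
        · exact hdil _ _ (by linarith)
        · exact hrem y c (List.mem_filter.1 hc).1
      · simp only [List.length_cons]
        omega
    · refine ⟨F ∪ ball x (800 * s), (x, 0, s) :: l, (x, 2 * s) :: C,
        Set.subset_union_left, hmeas x, ?_, ?_, ?_, ?_, ?_, hmass x⟩
      · intro A hA
        rcases List.mem_cons.1 hA with rfl | hA
        · refine ⟨le_rfl, hs0, by simp only; linarith, hx.trans (measure_mono ?_)⟩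
          rintro z ⟨hzx, -⟩
          exact ⟨dist_nonneg, hzx⟩
        · exact h.valid A hA
      · refine List.pairwise_cons.2 ⟨fun B hB => Set.disjoint_left.2 ?_, h.disjoint⟩
        rintro z ⟨-, hz⟩ hzB
        obtain ⟨c, hc, hzc⟩ := h.covered B hB z hzB
        exact hleaf ⟨c, hc, z, hz, hzc⟩
      · intro A hA z hz
        rcases List.mem_cons.1 hA with rfl | hA
        · exact ⟨_, List.mem_cons_self, hz.2⟩
        · obtain ⟨c, hc, hzc⟩ := h.covered A hA z hz
          exact ⟨c, List.mem_cons_of_mem _ hc, hzc⟩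
      · intro c hc
        rcases List.mem_cons.1 hc with rfl | hc
        · exact hdil _ _ (by linarith)
        · exact hrem x c hc
      · simp only [List.length_cons]
        omega

/-- Exhausting the heavy balls of radius `s`, unless `k` annuli are found before. -/
theorem exhaust [BorelSpace X] (h : AnnulusConfig μ v w F l C t) (hv : v ≠ 0) {s : ℝ}
    (hs0 : 0 < s) (hs : s ≤ 1 / 1600) (hw : ∀ p, μ (ball p (800 * s) \ F) ≤ w) (k : ℕ) :
    ∃ F' l' C' t', AnnulusConfig μ v w F' l' C' t' ∧
      (k ≤ l'.length ∨ ∀ p, μ (ball p s \ F') < v) := by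
  induction hd : 2 * k - t using Nat.strong_induction_on generalizing F l C t with
  | _ d ih =>
    by_cases hk : k ≤ l.length
    · exact ⟨F, l, C, t, h, Or.inl hk⟩
    by_cases hheavy : ∀ p, μ (ball p s \ F) < v
    · exact ⟨F, l, C, t, h, Or.inr hheavy⟩
    push Not at hheavy
    obtain ⟨x, hx⟩ := hheavy
    obtain ⟨F', l', C', hF, h'⟩ := h.step hv hs0 hs hw hx
    have hcount := h.count
    exact ih (2 * k - (t + 1)) (by omega) h'
      (fun p => (measure_mono (Set.sdiff_subset_sdiff_right hF)).trans (hw p)) rfl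

end AnnulusConfig

/-- Either there are `k` annuli, or after removing a set of small measure all balls of radius
`1 / 1600` are light. -/
theorem exists_annulusConfig {X : Type*} [PseudoMetricSpace X] [MeasurableSpace X] [BorelSpace X]
    {μ : Measure X} {v : ℝ≥0∞} (hv : v ≠ 0) {n : ℕ}
    (hcov : ∀ (p : X) (t : ℝ), 0 < t → t ≤ 1 →
      ∃ f : Fin n → X, ball p t ⊆ ⋃ i, ball (f i) (t / 1600))
    {δ : ℝ} (hδ : 0 < δ) (hsmall : ∀ p, μ (ball p δ) < v) (k : ℕ) :
    ∃ F l C t, AnnulusConfig μ v (n * v) F l C t ∧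
      (k ≤ l.length ∨ ∀ p, μ (ball p (1 / 1600) \ F) < v) := by
  obtain ⟨J, hJ⟩ : ∃ J : ℕ, (1 / 1600 : ℝ) * (1 / 2) ^ J < δ := by
    obtain ⟨J, hJ⟩ := exists_pow_lt_of_lt_one hδ (by norm_num : (1 / 2 : ℝ) < 1)
    exact ⟨J, lt_of_le_of_lt (mul_le_of_le_one_left (by positivity) (by norm_num)) hJ⟩
  suffices h : ∀ j ≤ J, ∃ F l C t, AnnulusConfig μ v (n * v) F l C t ∧
      (k ≤ l.length ∨ ∀ p, μ (ball p ((1 / 1600) * (1 / 2) ^ (J - j)) \ F) < v) by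
    simpa using h J le_rfl
  intro j hj
  induction j with
  | zero =>
    refine ⟨∅, [], [], 0, AnnulusConfig.nil, Or.inr fun p => ?_⟩
    refine (measure_mono ?_).trans_lt (hsmall p)
    exact Set.sdiff_subset.trans (ball_subset_ball hJ.le)
  | succ j ih =>
    obtain ⟨F, l, C, t, h, hk | hlight⟩ := ih (by omega)
    · exact ⟨F, l, C, t, h, Or.inl hk⟩
    have hpow : (1 / 2 : ℝ) ^ (J - j) = (1 / 2) ^ (J - (j + 1)) / 2 := by
      rw [show J - j = J - (j + 1) + 1 by omega, pow_succ]
      ring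
    set s : ℝ := (1 / 1600) * (1 / 2) ^ (J - (j + 1)) with hs
    have hs0 : 0 < s := by positivity
    have hs1 : s ≤ 1 / 1600 :=
      mul_le_of_le_one_right (by norm_num) (pow_le_one₀ (by norm_num) (by norm_num))
    refine h.exhaust hv hs0 hs1 (fun p => ?_) k
    obtain ⟨f, hf⟩ := hcov p (800 * s) (by positivity) (by linarith)
    have hrad : (1 / 1600 : ℝ) * (1 / 2) ^ (J - j) = 800 * s / 1600 := by
      rw [hpow, hs]
      ring
    rw [hrad] at hlight
    simpa using measure_diff_le_of_subset_iUnion μ (G := F) hf fun i => (hlight (f i)).le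

/-- Concentric annuli with geometrically decreasing radii have pairwise disjoint doubles. -/
theorem exists_concentric_annuli {X : Type*} [PseudoMetricSpace X] (p : X) (k : ℕ) :
    ∃ R : Fin k → ℝ, (∀ i, 0 < R i ∧ R i ≤ 1) ∧ Pairwise fun i j =>
      Disjoint (annulus p (R i / 2 / 2) (2 * R i)) (annulus p (R j / 2 / 2) (2 * R j)) := by
  have key : ∀ i j : ℕ, i < j →
      Disjoint (annulus p ((1 / 16 : ℝ) ^ i / 2 / 2) (2 * (1 / 16) ^ i))
        (annulus p ((1 / 16 : ℝ) ^ j / 2 / 2) (2 * (1 / 16) ^ j)) := by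
    intro i j hij
    rw [Set.disjoint_left]
    rintro z ⟨hz, -⟩ ⟨-, hz'⟩
    have h : (1 / 16 : ℝ) ^ j ≤ (1 / 16) ^ (i + 1) :=
      pow_le_pow_of_le_one (by norm_num) (by norm_num) hij
    have h0 : (0 : ℝ) < (1 / 16) ^ i := by positivity
    rw [pow_succ] at h
    linarith
  refine ⟨fun i => (1 / 16) ^ (i : ℕ),
    fun i => ⟨by positivity, pow_le_one₀ (by norm_num) (by norm_num)⟩, fun i j hij => ?_⟩
  rcases lt_or_gt_of_ne hij with h | h
  · exact key i j h
  · exact (key j i h).symm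

/-- Sets at mutual distance at least `3 * r` have disjoint `r`-neighbourhoods. -/
theorem disjoint_infDist_le {X : Type*} [PseudoMetricSpace X] {A B : Set X} {r : ℝ} (hr : 0 < r)
    (hA : A.Nonempty) (hB : B.Nonempty) (h : ∀ x ∈ A, ∀ y ∈ B, 3 * r ≤ dist x y) :
    Disjoint {x : X | infDist x A ≤ r} {x : X | infDist x B ≤ r} := by
  rw [Set.disjoint_left]
  intro z hzA hzB
  obtain ⟨a, ha, hza⟩ := (infDist_lt_iff hA).1
    (lt_of_le_of_lt hzA (by linarith : r < 3 / 2 * r))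
  obtain ⟨b, hb, hzb⟩ := (infDist_lt_iff hB).1
    (lt_of_le_of_lt hzB (by linarith : r < 3 / 2 * r))
  linarith [h a ha b hb, dist_triangle_left a b z]

/-- A cover by at most `n` balls can be indexed by `Fin n`. -/
theorem exists_fin_cover_of_finset_cover {X : Type*} [PseudoMetricSpace X] {S : Set X} (p : X)
    {r : ℝ} {n : ℕ} {s : Finset X} (hs : s.card ≤ n) (hS : S ⊆ ⋃ q ∈ s, ball q r) :
    ∃ f : Fin n → X, S ⊆ ⋃ i, ball (f i) r := by
  refine ⟨fun i => s.toList.getD i p, fun z hz => ?_⟩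
  obtain ⟨q, hq, hzq⟩ := Set.mem_iUnion₂.1 (hS hz)
  obtain ⟨i, hi, hiq⟩ := List.mem_iff_getElem.1 (Finset.mem_toList.2 hq)
  have hin : i < n := (Finset.length_toList s ▸ hi).trans_le hs
  refine Set.mem_iUnion.2 ⟨⟨i, hin⟩, ?_⟩
  change z ∈ ball (s.toList.getD i p) r
  rwa [List.getD_eq_getElem _ _ hi, hiq]

/-- Proposition 3.2 of the paper: let `(X,d)` be a separable pseudo-metric space
with precompact balls and `N` a (nondecreasing, positive) small cover refinement
function for it. Then for any finite non-atomic Borel measure `μ` and any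
positive integer `k` there are `k` bounded Borel sets `A₁, …, A_k` with
`μ(Aᵢ) ≥ μ(X)/(ck)`, `c = 64·N(1600)`, such that either (i) all `Aᵢ` are annuli
with outer radii at most one whose doubled annuli are pairwise disjoint, or
(ii) the `r₀`-neighbourhoods of the `Aᵢ` with `r₀ = 1/1600` are pairwise
disjoint. -/
theorem decomposition_small_cover
    {X : Type*} [PseudoMetricSpace X] [TopologicalSpace.SeparableSpace X]
    [MeasurableSpace X] [BorelSpace X]
    (hprecompact : ∀ (p : X) (t : ℝ), IsCompact (closure (ball p t)))
    (N : ℝ → ℝ) (hNmono : MonotoneOn N (Set.Ioi 1))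
    (hNpos : ∀ ρ : ℝ, 1 < ρ → 0 < N ρ)
    (hcover : ∀ ρ : ℝ, 1 < ρ → ∀ (p : X) (t : ℝ), 0 < t → t ≤ 1 →
      ∃ s : Finset X, (s.card : ℝ) ≤ N ρ ∧ ball p t ⊆ ⋃ q ∈ s, ball q (t / ρ))
    (μ : Measure X) [IsFiniteMeasure μ]
    (hna : ∀ p : X, Tendsto (fun t : ℝ => μ (ball p t)) (𝓝[>] 0) (𝓝 0))
    (k : ℕ) (hk : 0 < k) :
    ∃ A : Fin k → Set X,
      (∀ i, MeasurableSet (A i) ∧ Bornology.IsBounded (A i) ∧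
        μ Set.univ / ENNReal.ofReal (64 * N 1600 * k) ≤ μ (A i)) ∧
      ((∃ (a : Fin k → X) (r R : Fin k → ℝ),
          (∀ i, 0 ≤ r i ∧ r i < R i ∧ R i ≤ 1 ∧
            A i = {x : X | r i ≤ dist x (a i) ∧ dist x (a i) < R i}) ∧
          Pairwise fun i j =>
            Disjoint {x : X | r i / 2 ≤ dist x (a i) ∧ dist x (a i) < 2 * R i}
              {x : X | r j / 2 ≤ dist x (a j) ∧ dist x (a j) < 2 * R j}) ∨
        Pairwise fun i j =>
          Disjoint {x : X | infDist x (A i) ≤ 1 / 1600}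
            {x : X | infDist x (A j) ≤ 1 / 1600}) := by
  rcases eq_or_ne (μ Set.univ) 0 with hM | hM
  · rcases isEmpty_or_nonempty X with hX | ⟨⟨p⟩⟩
    · refine ⟨fun _ => ∅, fun i => ⟨MeasurableSet.empty, Bornology.isBounded_empty, ?_⟩,
        Or.inr fun i j _ => ?_⟩
      · simp [hM]
      · exact Set.disjoint_left.2 fun x => isEmptyElim x
    · obtain ⟨R, hR, hdisj⟩ := exists_concentric_annuli p k
      refine ⟨fun i => annulus p (R i / 2) (R i), fun i => ⟨measurableSet_annulus _ _ _,
        isBounded_annulus _ _ _, by simp [hM]⟩, Or.inl ⟨fun _ => p, fun i => R i / 2, R,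
        fun i => ⟨by linarith [(hR i).1], by linarith [(hR i).1], (hR i).2, rfl⟩, hdisj⟩⟩
  have hX : Nonempty X := by
    by_contra h
    rw [not_nonempty_iff] at h
    simp [Set.eq_empty_of_isEmpty] at hM
  have hN : 0 < N 1600 := hNpos 1600 (by norm_num)
  have hkpos : (0 : ℝ) < k := Nat.cast_pos.2 hk
  set n : ℕ := ⌊N 1600⌋₊ with hn
  have hcov : ∀ (p : X) (t : ℝ), 0 < t → t ≤ 1 →
      ∃ f : Fin n → X, ball p t ⊆ ⋃ i, ball (f i) (t / 1600) := by
    intro p t ht ht1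
    obtain ⟨s, hs, hps⟩ := hcover 1600 (by norm_num) p t ht ht1
    exact exists_fin_cover_of_finset_cover p (Nat.le_floor hs) hps
  have hn1 : 1 ≤ n := by
    obtain ⟨p⟩ := hX
    obtain ⟨f, hf⟩ := hcov p 1 one_pos le_rfl
    obtain ⟨i, -⟩ := Set.mem_iUnion.1 (hf (mem_ball_self one_pos))
    exact i.pos
  set v : ℝ≥0∞ := μ Set.univ / ENNReal.ofReal (64 * N 1600 * k) with hvdef
  have hden0 : ENNReal.ofReal (64 * N 1600 * k) ≠ 0 :=
    (ENNReal.ofReal_pos.2 (by positivity)).ne'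
  have hv : v ≠ 0 := ENNReal.div_ne_zero.2 ⟨hM, ENNReal.ofReal_ne_top⟩
  have hvtop : v ≠ ∞ := ENNReal.div_ne_top (measure_ne_top _ _) hden0
  have hbound : ((64 * n * k : ℕ) : ℝ≥0∞) * v ≤ μ Set.univ := by
    calc ((64 * n * k : ℕ) : ℝ≥0∞) * v ≤ ENNReal.ofReal (64 * N 1600 * k) * v := by
          gcongr
          rw [← ENNReal.ofReal_natCast]
          apply ENNReal.ofReal_le_ofReal
          push_cast
          gcongr
          exact Nat.floor_le hN.le
      _ = μ Set.univ := ENNReal.mul_div_cancel hden0 ENNReal.ofReal_ne_top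
  obtain ⟨δ, hδ, hsmall⟩ := exists_radius_forall_measure_ball_lt hprecompact μ hna hv
  obtain ⟨F, l, C, t, hconf, hor⟩ := exists_annulusConfig hv hcov hδ hsmall k
  by_cases hl : k ≤ l.length
  · let g : Fin k → X × ℝ × ℝ := fun i => l.get (Fin.castLE hl i)
    have hg : ∀ i, g i ∈ l := fun i => l.get_mem _
    refine ⟨fun i => annulus (g i).1 (g i).2.1 (g i).2.2, fun i => ⟨measurableSet_annulus _ _ _,
      isBounded_annulus _ _ _, (hconf.valid _ (hg i)).2.2.2⟩, Or.inl ⟨fun i => (g i).1,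
      fun i => (g i).2.1, fun i => (g i).2.2, fun i => ?_, fun i j hij => ?_⟩⟩
    · obtain ⟨h1, h2, h3, -⟩ := hconf.valid _ (hg i)
      exact ⟨h1, h2, h3, rfl⟩
    · have hp := List.pairwise_iff_get.1 hconf.disjoint
      rcases lt_or_gt_of_ne hij with h | h
      · exact hp (Fin.castLE hl i) (Fin.castLE hl j) h
      · exact (hp (Fin.castLE hl j) (Fin.castLE hl i) h).symm
  · have hlight := hor.resolve_left hl
    have ht : t ≤ 2 * k := by
      have := hconf.count
      omega
    have hball : ∀ p, μ.restrict Fᶜ (ball p (1 / 1600)) ≤ v := fun p => by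
      rw [Measure.restrict_apply measurableSet_ball]
      exact (hlight p).le
    have hcov4 : ∀ p : X, ∃ f : Fin n → X, ball p (4 * (1 / 1600)) ⊆ ⋃ i, ball (f i) (1 / 1600) :=
      fun p => (hcov p 1 one_pos le_rfl).imp fun f hf =>
        (ball_subset_ball (by norm_num)).trans hf
    have hmass : k * (n * (2 * v)) + v < μ.restrict Fᶜ Set.univ := by
      rw [Measure.restrict_apply_univ]
      by_contra! hle
      have htot : μ Set.univ ≤ ((4 * n * k + 1 : ℕ) : ℝ≥0∞) * v := by
        rw [← measure_add_measure_compl hconf.measurableSet]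
        calc μ F + μ Fᶜ ≤ t * (n * v) + (k * (n * (2 * v)) + v) := add_le_add hconf.mass hle
          _ ≤ ((2 * k : ℕ) : ℝ≥0∞) * (n * v) + (k * (n * (2 * v)) + v) := by gcongr
          _ = ((4 * n * k + 1 : ℕ) : ℝ≥0∞) * v := by
            push_cast
            ring
      have hle' := hbound.trans htot
      rw [ENNReal.mul_le_mul_iff_left hv hvtop, Nat.cast_le] at hle'
      have : 0 < n * k := Nat.mul_pos hn1 hk
      nlinarith
    obtain ⟨A, hA, hsep⟩ :=
      exists_separated_heavy_sets (μ.restrict Fᶜ) (by norm_num) hcov4 hball k hmass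
    have hne : ∀ i, (A i).Nonempty := fun i => by
      rw [Set.nonempty_iff_ne_empty]
      intro he
      have := (hA i).2.2
      rw [he, measure_empty] at this
      exact hv (le_zero_iff.1 this)
    exact ⟨A, fun i => ⟨(hA i).1, (hA i).2.1, (hA i).2.2.trans (Measure.restrict_apply_le _ _)⟩,
      Or.inr fun i j hij => disjoint_infDist_le (by norm_num) (hne i) (hne j) (hsep hij)⟩
end
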